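/- arXiv:1105.1867 — 7 statements merged into one kernel-verified Lean document; each statement's English description precedes it below -/
import Mathlib

section
/- Let (E₁,E₂,E₃,κ,τ) be a Galilean Frenet frame, let γ : ℝ → ℝ be differentiable and φ ∈ ℝ a constant with sin φ ≠ 0, and suppose cos(γ(s)) ≠ 0 for every s. If the rotated frame (Ẽ₁,Ẽ₂,Ẽ₃) of (E₁,E₂,E₃) with angles γ, φ satisfies the third Galilean Frenet equation Ẽ₃' = -τ̃·Ẽ₂ for some function τ̃ : ℝ → ℝ, then the torsion is preserved, τ̃(s) = τ(s) for all s, and γ satisfies the differential equation dγ/ds = τ(s)·sin(γ(s))·tan(φ/2). -/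
open Real

theorem eq_coeffs_of_linearIndependent_three {V : Type*} [AddCommGroup V] [Module ℝ V]
    {u v w : V} (h : LinearIndependent ℝ ![u, v, w]) {a b c a' b' c' : ℝ}
    (heq : a • u + b • v + c • w = a' • u + b' • v + c' • w) :
    a = a' ∧ b = b' ∧ c = c' := by
  rw [Fintype.linearIndependent_iff] at h
  have hz := h ![a - a', b - b', c - c'] (by
    simp only [Fin.sum_univ_three, Matrix.cons_val]
    rw [← sub_eq_zero.mpr heq]
    module)
  exact ⟨sub_eq_zero.mp (hz 0), sub_eq_zero.mp (hz 1), sub_eq_zero.mp (hz 2)⟩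

theorem tan_half_mul_sin {x : ℝ} (hx : Real.sin x ≠ 0) :
    Real.tan (x / 2) * Real.sin x = 1 - Real.cos x := by
  have hs : Real.sin x = 2 * Real.sin (x / 2) * Real.cos (x / 2) := by
    rw [← Real.sin_two_mul]; ring_nf
  have hc : Real.cos x = 1 - 2 * Real.sin (x / 2) ^ 2 := by
    have h := Real.cos_two_mul' (x / 2)
    rw [mul_div_cancel₀ x two_ne_zero] at h
    linarith [Real.cos_sq_add_sin_sq (x / 2)]
  have h0 : Real.cos (x / 2) ≠ 0 := fun h => hx (by rw [hs, h, mul_zero])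
  rw [Real.tan_eq_sin_div_cos, hs, hc]
  field_simp
  ring

theorem stmt0
    (E₁ E₂ E₃ : ℝ → Fin 3 → ℝ) (κ τ : ℝ → ℝ)
    (hE₁ : Differentiable ℝ E₁) (hE₂ : Differentiable ℝ E₂) (hE₃ : Differentiable ℝ E₃)
    (hκ : Differentiable ℝ κ) (hτ : Differentiable ℝ τ)
    (hLI : ∀ s : ℝ, LinearIndependent ℝ ![E₁ s, E₂ s, E₃ s])
    (hFr1 : ∀ s : ℝ, deriv E₁ s = κ s • E₂ s)
    (hFr2 : ∀ s : ℝ, deriv E₂ s = τ s • E₃ s)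
    (hFr3 : ∀ s : ℝ, deriv E₃ s = (-(τ s)) • E₂ s)
    (γ : ℝ → ℝ) (hγ : Differentiable ℝ γ)
    (φ : ℝ) (hφ : Real.sin φ ≠ 0)
    (hcosγ : ∀ s : ℝ, Real.cos (γ s) ≠ 0)
    (F₁ F₂ F₃ : ℝ → Fin 3 → ℝ)
    (hR1 : ∀ s : ℝ, F₁ s = (Real.cos (γ s) ^ 2 + Real.sin (γ s) ^ 2 * Real.cos φ) • E₁ s + (Real.cos (γ s) * Real.sin (γ s) * (1 - Real.cos φ)) • E₂ s + (Real.sin (γ s) * Real.sin φ) • E₃ s)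
    (hR2 : ∀ s : ℝ, F₂ s = (Real.cos (γ s) * Real.sin (γ s) * (1 - Real.cos φ)) • E₁ s + (Real.sin (γ s) ^ 2 + Real.cos (γ s) ^ 2 * Real.cos φ) • E₂ s + (-(Real.cos (γ s) * Real.sin φ)) • E₃ s)
    (hR3 : ∀ s : ℝ, F₃ s = (-(Real.sin (γ s) * Real.sin φ)) • E₁ s + (Real.sin φ * Real.cos (γ s)) • E₂ s + (Real.cos φ) • E₃ s)
    (τ' : ℝ → ℝ)
    (hFr3' : ∀ s : ℝ, deriv F₃ s = (-(τ' s)) • F₂ s) :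
    (∀ s : ℝ, τ' s = τ s) ∧
    (∀ s : ℝ, deriv γ s = τ s * Real.sin (γ s) * Real.tan (φ / 2)) := by
  have key (s : ℝ) : τ' s = τ s ∧
      deriv γ s * Real.sin φ = τ' s * Real.sin (γ s) * (1 - Real.cos φ) := by
    have hg := (hγ s).hasDerivAt
    have h1 : HasDerivAt E₁ (κ s • E₂ s) s := hFr1 s ▸ (hE₁ s).hasDerivAt
    have h2 : HasDerivAt E₂ (τ s • E₃ s) s := hFr2 s ▸ (hE₂ s).hasDerivAt
    have h3 : HasDerivAt E₃ ((-(τ s)) • E₂ s) s := hFr3 s ▸ (hE₃ s).hasDerivAt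
    have hF := (((hg.sin.mul_const (Real.sin φ)).fun_neg.fun_smul h1).fun_add
      ((hg.cos.const_mul (Real.sin φ)).fun_smul h2)).fun_add (h3.fun_const_smul (Real.cos φ))
    have hd := hFr3' s
    rw [funext hR3, hF.deriv, hR2 s] at hd
    obtain ⟨ha, -, hc⟩ := eq_coeffs_of_linearIndependent_three (hLI s)
      (a := -(Real.cos (γ s) * deriv γ s * Real.sin φ))
      (b := -(Real.sin (γ s) * Real.sin φ) * κ s + Real.sin φ * (-Real.sin (γ s) * deriv γ s)
        - Real.cos φ * τ s)
      (c := Real.sin φ * Real.cos (γ s) * τ s)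
      (a' := -τ' s * (Real.cos (γ s) * Real.sin (γ s) * (1 - Real.cos φ)))
      (b' := -τ' s * (Real.sin (γ s) ^ 2 + Real.cos (γ s) ^ 2 * Real.cos φ))
      (c' := -τ' s * -(Real.cos (γ s) * Real.sin φ))
      (by convert hd using 1 <;> module)
    constructor
    · apply mul_left_cancel₀ (mul_ne_zero hφ (hcosγ s))
      linear_combination -hc
    · apply mul_left_cancel₀ (hcosγ s)
      linear_combination -ha
  refine ⟨fun s => (key s).1, fun s => mul_right_cancel₀ hφ ?_⟩
  rw [(key s).2, (key s).1, mul_assoc _ (Real.tan _), tan_half_mul_sin hφ]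
end

section
/- Let (E₁,E₂,E₃,κ,τ) be a Galilean Frenet frame, let γ : ℝ → ℝ be differentiable and φ ∈ ℝ a constant with sin φ ≠ 0, and suppose cos(γ(s)) ≠ 0 and sin(γ(s)) ≠ 0 for every s. If the rotated frame (Ẽ₁,Ẽ₂,Ẽ₃) of (E₁,E₂,E₃) with angles γ, φ satisfies the first Galilean Frenet equation Ẽ₁' = κ̃·Ẽ₂ for some function κ̃ : ℝ → ℝ, then the curvature of the rotated frame satisfies κ̃(s) = −2·(dγ/ds)(s) for all s. -/
open Real

theorem stmt1
    (E₁ E₂ E₃ : ℝ → Fin 3 → ℝ) (κ τ : ℝ → ℝ)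
    (hE₁ : Differentiable ℝ E₁) (hE₂ : Differentiable ℝ E₂) (hE₃ : Differentiable ℝ E₃)
    (hκ : Differentiable ℝ κ) (hτ : Differentiable ℝ τ)
    (hLI : ∀ s : ℝ, LinearIndependent ℝ ![E₁ s, E₂ s, E₃ s])
    (hFr1 : ∀ s : ℝ, deriv E₁ s = κ s • E₂ s)
    (hFr2 : ∀ s : ℝ, deriv E₂ s = τ s • E₃ s)
    (hFr3 : ∀ s : ℝ, deriv E₃ s = (-(τ s)) • E₂ s)
    (γ : ℝ → ℝ) (hγ : Differentiable ℝ γ)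
    (φ : ℝ) (hφ : Real.sin φ ≠ 0)
    (hcosγ : ∀ s : ℝ, Real.cos (γ s) ≠ 0)
    (hsinγ : ∀ s : ℝ, Real.sin (γ s) ≠ 0)
    (F₁ F₂ F₃ : ℝ → Fin 3 → ℝ)
    (hR1 : ∀ s : ℝ, F₁ s = (Real.cos (γ s) ^ 2 + Real.sin (γ s) ^ 2 * Real.cos φ) • E₁ s + (Real.cos (γ s) * Real.sin (γ s) * (1 - Real.cos φ)) • E₂ s + (Real.sin (γ s) * Real.sin φ) • E₃ s)
    (hR2 : ∀ s : ℝ, F₂ s = (Real.cos (γ s) * Real.sin (γ s) * (1 - Real.cos φ)) • E₁ s + (Real.sin (γ s) ^ 2 + Real.cos (γ s) ^ 2 * Real.cos φ) • E₂ s + (-(Real.cos (γ s) * Real.sin φ)) • E₃ s)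
    (hR3 : ∀ s : ℝ, F₃ s = (-(Real.sin (γ s) * Real.sin φ)) • E₁ s + (Real.sin φ * Real.cos (γ s)) • E₂ s + (Real.cos φ) • E₃ s)
    (κ' : ℝ → ℝ)
    (hFr1' : ∀ s : ℝ, deriv F₁ s = κ' s • F₂ s) :
    ∀ s : ℝ, κ' s = -2 * deriv γ s := by
  intro s
  have hc := (hγ s).hasDerivAt.cos
  have hs := (hγ s).hasDerivAt.sin
  have ha := (hc.pow 2).add ((hs.pow 2).mul_const (cos φ))
  have hb := (hc.mul hs).mul_const (1 - cos φ)
  have hd := hs.mul_const (sin φ)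
  have hF := ((ha.smul (hE₁ s).hasDerivAt).add (hb.smul (hE₂ s).hasDerivAt)).add
    (hd.smul (hE₃ s).hasDerivAt)
  have hderiv := (hF.congr_of_eventuallyEq (Filter.Eventually.of_forall hR1)).deriv
  rw [hFr1' s, hR2 s, hFr1 s, hFr2 s, hFr3 s] at hderiv
  have hcoeff : -2 * deriv γ s * (cos (γ s) * sin (γ s) * (1 - cos φ)) =
      κ' s * (cos (γ s) * sin (γ s) * (1 - cos φ)) := by
    have hzero := Fintype.linearIndependent_iff.mp (hLI s)
      ![-2 * deriv γ s * (cos (γ s) * sin (γ s) * (1 - cos φ)) -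
          κ' s * (cos (γ s) * sin (γ s) * (1 - cos φ)),
        (cos (γ s) ^ 2 + sin (γ s) ^ 2 * cos φ) * κ s +
          (cos (γ s) ^ 2 - sin (γ s) ^ 2) * deriv γ s * (1 - cos φ) -
          sin (γ s) * sin φ * τ s - κ' s * (sin (γ s) ^ 2 + cos (γ s) ^ 2 * cos φ),
        cos (γ s) * sin (γ s) * (1 - cos φ) * τ s + cos (γ s) * deriv γ s * sin φ +
          κ' s * (cos (γ s) * sin φ)]
    refine sub_eq_zero.mp (hzero ?_ 0)
    ext i
    have hi := congrFun hderiv i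
    simp [Fin.sum_univ_three] at hi ⊢
    linear_combination -hi
  have hφ' : 1 - cos φ ≠ 0 := by
    intro h
    exact hφ (sin_eq_zero_iff_cos_eq.mpr (Or.inl (by linarith)))
  exact (mul_right_cancel₀ (mul_ne_zero (mul_ne_zero (hcosγ s) (hsinγ s)) hφ') hcoeff).symm
end

section
/- Let (E₁,E₂,E₃,κ,τ) be a Galilean Frenet frame, let γ : ℝ → ℝ be differentiable, φ ∈ ℝ a constant with sin φ ≠ 0, r ∈ ℝ a nonzero constant, and suppose sin(γ(s)) ≠ 0 for every s. Let α, α̃ : ℝ → ℝ³ be differentiable curves with α' = E₁, α̃' = Ẽ₁ (the first vector of the rotated frame of (E₁,E₂,E₃) with angles γ, φ), and suppose the distance vector satisfies α̃(s) − α(s) = r·(cos(γ(s))·E₁(s) + sin(γ(s))·E₂(s)) for all s. Then τ(s) = sin φ / r for all s; in particular the torsion τ is constant. -/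
open Real

theorem stmt2
    (E₁ E₂ E₃ : ℝ → Fin 3 → ℝ) (κ τ : ℝ → ℝ)
    (hE₁ : Differentiable ℝ E₁) (hE₂ : Differentiable ℝ E₂) (hE₃ : Differentiable ℝ E₃)
    (hκ : Differentiable ℝ κ) (hτ : Differentiable ℝ τ)
    (hLI : ∀ s : ℝ, LinearIndependent ℝ ![E₁ s, E₂ s, E₃ s])
    (hFr1 : ∀ s : ℝ, deriv E₁ s = κ s • E₂ s)
    (hFr2 : ∀ s : ℝ, deriv E₂ s = τ s • E₃ s)
    (hFr3 : ∀ s : ℝ, deriv E₃ s = (-(τ s)) • E₂ s)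
    (γ : ℝ → ℝ) (hγ : Differentiable ℝ γ)
    (φ : ℝ) (hφ : Real.sin φ ≠ 0)
    (r : ℝ) (hr : r ≠ 0)
    (hsinγ : ∀ s : ℝ, Real.sin (γ s) ≠ 0)
    (F₁ F₂ F₃ : ℝ → Fin 3 → ℝ)
    (hR1 : ∀ s : ℝ, F₁ s = (Real.cos (γ s) ^ 2 + Real.sin (γ s) ^ 2 * Real.cos φ) • E₁ s + (Real.cos (γ s) * Real.sin (γ s) * (1 - Real.cos φ)) • E₂ s + (Real.sin (γ s) * Real.sin φ) • E₃ s)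
    (hR2 : ∀ s : ℝ, F₂ s = (Real.cos (γ s) * Real.sin (γ s) * (1 - Real.cos φ)) • E₁ s + (Real.sin (γ s) ^ 2 + Real.cos (γ s) ^ 2 * Real.cos φ) • E₂ s + (-(Real.cos (γ s) * Real.sin φ)) • E₃ s)
    (hR3 : ∀ s : ℝ, F₃ s = (-(Real.sin (γ s) * Real.sin φ)) • E₁ s + (Real.sin φ * Real.cos (γ s)) • E₂ s + (Real.cos φ) • E₃ s)
    (α α' : ℝ → Fin 3 → ℝ)
    (hα : Differentiable ℝ α) (hα' : Differentiable ℝ α')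
    (hαE : ∀ s : ℝ, deriv α s = E₁ s)
    (hα'E : ∀ s : ℝ, deriv α' s = F₁ s)
    (hdist : ∀ s : ℝ, α' s - α s = r • (Real.cos (γ s) • E₁ s + Real.sin (γ s) • E₂ s))
    :
    ∀ s : ℝ, τ s = Real.sin φ / r := by
  intro s
  have hE₁' : HasDerivAt E₁ (κ s • E₂ s) s := hFr1 s ▸ (hE₁ s).hasDerivAt
  have hE₂' : HasDerivAt E₂ (τ s • E₃ s) s := hFr2 s ▸ (hE₂ s).hasDerivAt
  have hdiff : HasDerivAt (fun t => α' t - α t) (F₁ s - E₁ s) s :=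
    (hα'E s ▸ (hα' s).hasDerivAt).sub (hαE s ▸ (hα s).hasDerivAt)
  rw [funext hdist] at hdiff
  have hγ' := (hγ s).hasDerivAt
  have heq := hdiff.unique (((hγ'.cos.smul hE₁').add (hγ'.sin.smul hE₂')).const_smul r)
  have hE₃coeff := (Fintype.linearIndependent_iff.mp (hLI s))
    ![cos (γ s) ^ 2 + sin (γ s) ^ 2 * cos φ - 1 + r * sin (γ s) * deriv γ s,
      cos (γ s) * sin (γ s) * (1 - cos φ) - r * cos (γ s) * (κ s + deriv γ s),
      sin (γ s) * sin φ - r * sin (γ s) * τ s] (by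
      rw [hR1 s, ← sub_eq_zero] at heq
      simp only [Fin.sum_univ_three, Matrix.cons_val]
      rw [← heq]
      module) 2
  simp only [Matrix.cons_val] at hE₃coeff
  rw [eq_div_iff hr]
  refine mul_left_cancel₀ (hsinγ s) ?_
  linear_combination -hE₃coeff
end

section
/- Let (E₁,E₂,E₃,κ,τ) be a pseudo-Galilean Frenet frame, let γ : ℝ → ℝ be differentiable, φ ∈ ℝ a nonzero constant, r ∈ ℝ a nonzero constant, and suppose sin(γ(s)) ≠ 0 for every s. Let α, α̃ : ℝ → ℝ³ be differentiable curves with α' = E₁, α̃' = Ẽ₁ (the first vector of the hyperbolically rotated frame of (E₁,E₂,E₃) with angles γ, φ), and suppose the distance vector satisfies α̃(s) − α(s) = r·(cos(γ(s))·E₁(s) + sin(γ(s))·E₂(s)) for all s. Then τ(s) = −sinh φ / r for all s; in particular the torsion τ is constant. -/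
open Real

theorem stmt5
    (E₁ E₂ E₃ : ℝ → Fin 3 → ℝ) (κ τ : ℝ → ℝ)
    (hE₁ : Differentiable ℝ E₁) (hE₂ : Differentiable ℝ E₂) (hE₃ : Differentiable ℝ E₃)
    (hκ : Differentiable ℝ κ) (hτ : Differentiable ℝ τ)
    (hLI : ∀ s : ℝ, LinearIndependent ℝ ![E₁ s, E₂ s, E₃ s])
    (hFr1 : ∀ s : ℝ, deriv E₁ s = κ s • E₂ s)
    (hFr2 : ∀ s : ℝ, deriv E₂ s = τ s • E₃ s)
    (hFr3 : ∀ s : ℝ, deriv E₃ s = τ s • E₂ s)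
    (γ : ℝ → ℝ) (hγ : Differentiable ℝ γ)
    (φ : ℝ) (hφ : φ ≠ 0)
    (r : ℝ) (hr : r ≠ 0)
    (hsinγ : ∀ s : ℝ, Real.sin (γ s) ≠ 0)
    (F₁ F₂ F₃ : ℝ → Fin 3 → ℝ)
    (hR1 : ∀ s : ℝ, F₁ s = (Real.cos (γ s) ^ 2 + Real.sin (γ s) ^ 2 * Real.cosh φ) • E₁ s + (Real.cos (γ s) * Real.sin (γ s) * (1 - Real.cosh φ)) • E₂ s + (-(Real.sin (γ s) * Real.sinh φ)) • E₃ s)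
    (hR2 : ∀ s : ℝ, F₂ s = (Real.cos (γ s) * Real.sin (γ s) * (1 - Real.cosh φ)) • E₁ s + (Real.sin (γ s) ^ 2 + Real.cos (γ s) ^ 2 * Real.cosh φ) • E₂ s + (Real.cos (γ s) * Real.sinh φ) • E₃ s)
    (hR3 : ∀ s : ℝ, F₃ s = (-(Real.sin (γ s) * Real.sinh φ)) • E₁ s + (Real.sinh φ * Real.cos (γ s)) • E₂ s + (Real.cosh φ) • E₃ s)
    (α α' : ℝ → Fin 3 → ℝ)
    (hα : Differentiable ℝ α) (hα' : Differentiable ℝ α')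
    (hαE : ∀ s : ℝ, deriv α s = E₁ s)
    (hα'E : ∀ s : ℝ, deriv α' s = F₁ s)
    (hdist : ∀ s : ℝ, α' s - α s = r • (Real.cos (γ s) • E₁ s + Real.sin (γ s) • E₂ s))
    :
    ∀ s : ℝ, τ s = -Real.sinh φ / r := by
  intro s
  have hd₁ : HasDerivAt E₁ (κ s • E₂ s) s := hFr1 s ▸ (hE₁ s).hasDerivAt
  have hd₂ : HasDerivAt E₂ (τ s • E₃ s) s := hFr2 s ▸ (hE₂ s).hasDerivAt
  have hγs := (hγ s).hasDerivAt
  have hrhs := ((hγs.cos.smul hd₁).add (hγs.sin.smul hd₂)).const_smul r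
  have hlhs : HasDerivAt (fun t => α' t - α t) (F₁ s - E₁ s) s := by
    rw [← hα'E s, ← hαE s]
    exact (hα' s).hasDerivAt.sub (hα s).hasDerivAt
  rw [funext hdist] at hlhs
  have heq := hlhs.unique hrhs
  rw [hR1 s] at heq
  have hcomb := Fintype.linearIndependent_iff.mp (hLI s)
    ![cos (γ s) ^ 2 + sin (γ s) ^ 2 * cosh φ - 1 + r * (sin (γ s) * deriv γ s),
      cos (γ s) * sin (γ s) * (1 - cosh φ) - r * (cos (γ s) * κ s + cos (γ s) * deriv γ s),
      -(sin (γ s) * sinh φ) - r * (sin (γ s) * τ s)]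
    (by
      rw [Fin.sum_univ_three]
      ext i
      have hi := congrFun heq i
      simp only [Pi.add_apply, Pi.sub_apply, Pi.smul_apply, smul_eq_mul] at hi
      simp
      linear_combination hi) 2
  have hcoeff : -(sin (γ s) * sinh φ) - r * (sin (γ s) * τ s) = 0 := hcomb
  rw [eq_div_iff hr]
  apply mul_left_cancel₀ (hsinγ s)
  linear_combination -hcoeff
end

section
/- Let (E₁,E₂,E₃,κ,τ) be a pseudo-Galilean Frenet frame, let γ : ℝ → ℝ be differentiable and φ ∈ ℝ a nonzero constant. If the doubly hyperbolically rotated frame (Ẽ₁,Ẽ₂,Ẽ₃) of (E₁,E₂,E₃) with angles γ, φ satisfies the third pseudo-Galilean Frenet equation Ẽ₃' = τ̃·Ẽ₂ for some function τ̃ : ℝ → ℝ, then the torsion changes sign, τ̃(s) = −τ(s) for all s, and γ satisfies the differential equation dγ/ds = −τ̃(s)·sinh(γ(s))·tanh(φ/2), equivalently dγ/ds = τ(s)·sinh(γ(s))·tanh(φ/2). -/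
open Real

theorem tanh_half_mul_sinh (x : ℝ) : Real.tanh (x / 2) * Real.sinh x = Real.cosh x - 1 := by
  have hx : x = 2 * (x / 2) := by ring
  have hs : Real.sinh x = 2 * Real.sinh (x / 2) * Real.cosh (x / 2) := by
    conv_lhs => rw [hx, Real.sinh_two_mul]
  have hc : Real.cosh x = Real.cosh (x / 2) ^ 2 + Real.sinh (x / 2) ^ 2 := by
    conv_lhs => rw [hx, Real.cosh_two_mul]
  have hpos := (Real.cosh_pos (x / 2)).ne'
  rw [Real.tanh_eq_sinh_div_cosh, hs, hc, Real.cosh_sq]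
  field_simp
  ring

theorem LinearIndependent.coeff_eq_zero_of_triple {R M : Type*} [Ring R] [AddCommGroup M]
    [Module R M] {u v w : M} (h : LinearIndependent R ![u, v, w]) {a b c : R}
    (habc : a • u + b • v + c • w = 0) : a = 0 ∧ b = 0 ∧ c = 0 := by
  have key := Fintype.linearIndependent_iff.1 h ![a, b, c] (by simpa [Fin.sum_univ_three] using habc)
  exact ⟨key 0, key 1, key 2⟩

theorem stmt7
    (E₁ E₂ E₃ : ℝ → Fin 3 → ℝ) (κ τ : ℝ → ℝ)
    (hE₁ : Differentiable ℝ E₁) (hE₂ : Differentiable ℝ E₂) (hE₃ : Differentiable ℝ E₃)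
    (hκ : Differentiable ℝ κ) (hτ : Differentiable ℝ τ)
    (hLI : ∀ s : ℝ, LinearIndependent ℝ ![E₁ s, E₂ s, E₃ s])
    (hFr1 : ∀ s : ℝ, deriv E₁ s = κ s • E₂ s)
    (hFr2 : ∀ s : ℝ, deriv E₂ s = τ s • E₃ s)
    (hFr3 : ∀ s : ℝ, deriv E₃ s = τ s • E₂ s)
    (γ : ℝ → ℝ) (hγ : Differentiable ℝ γ)
    (φ : ℝ) (hφ : φ ≠ 0)
    (F₁ F₂ F₃ : ℝ → Fin 3 → ℝ)
    (hR1 : ∀ s : ℝ, F₁ s = (Real.cosh (γ s) ^ 2 - Real.sinh (γ s) ^ 2 * Real.cosh φ) • E₁ s + (Real.cosh (γ s) * Real.sinh (γ s) * (1 - Real.cosh φ)) • E₂ s + (-(Real.sinh (γ s) * Real.sinh φ)) • E₃ s)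
    (hR2 : ∀ s : ℝ, F₂ s = (Real.cosh (γ s) * Real.sinh (γ s) * (Real.cosh φ - 1)) • E₁ s + (Real.cosh (γ s) ^ 2 * Real.cosh φ - Real.sinh (γ s) ^ 2) • E₂ s + (Real.cosh (γ s) * Real.sinh φ) • E₃ s)
    (hR3 : ∀ s : ℝ, F₃ s = (-(Real.sinh (γ s) * Real.sinh φ)) • E₁ s + (-(Real.sinh φ * Real.cosh (γ s))) • E₂ s + (Real.cosh φ) • E₃ s)
    (τ' : ℝ → ℝ)
    (hFr3' : ∀ s : ℝ, deriv F₃ s = τ' s • F₂ s) :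
    (∀ s : ℝ, τ' s = -τ s) ∧
    (∀ s : ℝ, deriv γ s = -(τ' s) * Real.sinh (γ s) * Real.tanh (φ / 2)) ∧
    (∀ s : ℝ, deriv γ s = τ s * Real.sinh (γ s) * Real.tanh (φ / 2)) := by
  have hsinh : Real.sinh φ ≠ 0 := Real.sinh_ne_zero.2 hφ
  have main : ∀ s : ℝ, τ' s = -τ s ∧
      deriv γ s = τ s * Real.sinh (γ s) * Real.tanh (φ / 2) := by
    intro s
    have hcosh := (Real.cosh_pos (γ s)).ne'
    have d1 := (hE₁ s).hasDerivAt
    have d2 := (hE₂ s).hasDerivAt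
    have d3 := (hE₃ s).hasDerivAt
    have dγ := (hγ s).hasDerivAt
    rw [hFr1] at d1
    rw [hFr2] at d2
    rw [hFr3] at d3
    have hd := ((((dγ.sinh.mul_const (Real.sinh φ)).neg).smul d1).add
      (((dγ.cosh.const_mul (Real.sinh φ)).neg).smul d2)).add (d3.const_smul (Real.cosh φ))
    have hF := (hd.congr_of_eventuallyEq (Filter.Eventually.of_forall hR3)).deriv
    rw [hFr3', hR2] at hF
    have hzero :
        (τ' s * (Real.cosh (γ s) * Real.sinh (γ s) * (Real.cosh φ - 1)) +
          Real.cosh (γ s) * deriv γ s * Real.sinh φ) • E₁ s +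
        (τ' s * (Real.cosh (γ s) ^ 2 * Real.cosh φ - Real.sinh (γ s) ^ 2) +
          Real.sinh (γ s) * Real.sinh φ * κ s +
          Real.sinh φ * (Real.sinh (γ s) * deriv γ s) - Real.cosh φ * τ s) • E₂ s +
        (τ' s * (Real.cosh (γ s) * Real.sinh φ) +
          Real.sinh φ * Real.cosh (γ s) * τ s) • E₃ s = 0 := by
      rw [← sub_eq_zero] at hF
      rw [← hF]
      simp only [Pi.neg_apply]
      module
    obtain ⟨h1, -, h3⟩ := (hLI s).coeff_eq_zero_of_triple hzero
    have hτ' : τ' s = -τ s := by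
      apply mul_right_cancel₀ (mul_ne_zero hcosh hsinh)
      linear_combination h3
    refine ⟨hτ', mul_right_cancel₀ (mul_ne_zero hcosh hsinh) ?_⟩
    rw [hτ'] at h1
    linear_combination h1 - τ s * Real.sinh (γ s) * Real.cosh (γ s) * tanh_half_mul_sinh φ
  refine ⟨fun s => (main s).1, fun s => ?_, fun s => (main s).2⟩
  rw [(main s).1, neg_neg]
  exact (main s).2
end

section
/- Let (E₁,E₂,E₃,E₄,κ,τ,σ) be a Galilean Frenet frame in G⁴, let γ : ℝ → ℝ be differentiable and φ ∈ ℝ a constant with sin φ ≠ 0, and suppose cos(γ(s)) ≠ 0 for every s. If the spatially rotated frame (Ẽ₁,Ẽ₂,Ẽ₃,Ẽ₄) of (E₁,E₂,E₃,E₄) with angles γ, φ satisfies the third Frenet equation Ẽ₃' = −τ̃·Ẽ₂ for some function τ̃ : ℝ → ℝ, then the torsion is preserved, τ̃(s) = τ(s) for all s, and γ satisfies the differential equation dγ/ds = τ(s)·sin(γ(s))·tan(φ/2) − κ(s). -/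
open Real

/-- The half-angle formula `tan (φ / 2) = (1 - cos φ) / sin φ`, cleared of denominators. -/
theorem sin_mul_tan_half {φ : ℝ} (hφ : Real.sin φ ≠ 0) :
    Real.sin φ * Real.tan (φ / 2) = 1 - Real.cos φ := by
  obtain ⟨x, rfl⟩ : ∃ x, φ = 2 * x := ⟨φ / 2, by ring⟩
  have hx : Real.cos x ≠ 0 := by
    intro h
    simp [Real.sin_two_mul, h] at hφ
  rw [mul_div_cancel_left₀ x two_ne_zero, Real.tan_eq_sin_div_cos, Real.sin_two_mul,
    Real.cos_two_mul]
  field_simp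
  linear_combination 2 * Real.sin_sq_add_cos_sq x

theorem stmt10
    (E₁ E₂ E₃ E₄ : ℝ → Fin 4 → ℝ) (κ τ σ : ℝ → ℝ)
    (hE₁ : Differentiable ℝ E₁) (hE₂ : Differentiable ℝ E₂)
    (hE₃ : Differentiable ℝ E₃) (hE₄ : Differentiable ℝ E₄)
    (hκ : Differentiable ℝ κ) (hτ : Differentiable ℝ τ) (hσ : Differentiable ℝ σ)
    (hLI : ∀ s : ℝ, LinearIndependent ℝ ![E₁ s, E₂ s, E₃ s, E₄ s])
    (hFr1 : ∀ s : ℝ, deriv E₁ s = κ s • E₂ s)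
    (hFr2 : ∀ s : ℝ, deriv E₂ s = (-(κ s)) • E₁ s + τ s • E₃ s)
    (hFr3 : ∀ s : ℝ, deriv E₃ s = (-(τ s)) • E₂ s)
    (hFr4 : ∀ s : ℝ, deriv E₄ s = (-(σ s)) • E₃ s)
    (γ : ℝ → ℝ) (hγ : Differentiable ℝ γ)
    (φ : ℝ) (hφ : Real.sin φ ≠ 0)
    (hcosγ : ∀ s : ℝ, Real.cos (γ s) ≠ 0)
    (F₁ F₂ F₃ F₄ : ℝ → Fin 4 → ℝ)
    (hR1 : ∀ s : ℝ, F₁ s = (Real.cos (γ s) ^ 2 + Real.sin (γ s) ^ 2 * Real.cos φ) • E₁ s + (Real.cos (γ s) * Real.sin (γ s) * (1 - Real.cos φ)) • E₂ s + (Real.sin (γ s) * Real.sin φ) • E₃ s)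
    (hR2 : ∀ s : ℝ, F₂ s = (Real.cos (γ s) * Real.sin (γ s) * (1 - Real.cos φ)) • E₁ s + (Real.sin (γ s) ^ 2 + Real.cos (γ s) ^ 2 * Real.cos φ) • E₂ s + (-(Real.cos (γ s) * Real.sin φ)) • E₃ s)
    (hR3 : ∀ s : ℝ, F₃ s = (-(Real.sin (γ s) * Real.sin φ)) • E₁ s + (Real.sin φ * Real.cos (γ s)) • E₂ s + (Real.cos φ) • E₃ s)
    (hR4 : ∀ s : ℝ, F₄ s = E₄ s)
    (τ' : ℝ → ℝ)
    (hFr3' : ∀ s : ℝ, deriv F₃ s = (-(τ' s)) • F₂ s) :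
    (∀ s : ℝ, τ' s = τ s) ∧
    (∀ s : ℝ, deriv γ s = τ s * Real.sin (γ s) * Real.tan (φ / 2) - κ s) := by
  have key : ∀ s, τ' s = τ s ∧
      deriv γ s + κ s = τ s * Real.sin (γ s) * Real.tan (φ / 2) := by
    intro s
    have h1 : HasDerivAt E₁ (κ s • E₂ s) s := hFr1 s ▸ (hE₁ s).hasDerivAt
    have h2 : HasDerivAt E₂ ((-(κ s)) • E₁ s + τ s • E₃ s) s := hFr2 s ▸ (hE₂ s).hasDerivAt
    have h3 : HasDerivAt E₃ ((-(τ s)) • E₂ s) s := hFr3 s ▸ (hE₃ s).hasDerivAt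
    have hg := (hγ s).hasDerivAt
    have hF := (((hg.sin.mul_const (Real.sin φ)).neg.smul h1).add
      ((hg.cos.const_mul (Real.sin φ)).smul h2)).add (h3.const_smul (Real.cos φ))
    have hF₃ := (hF.congr_of_eventuallyEq (Filter.Eventually.of_forall hR3)).deriv
    rw [hFr3' s, hR2 s] at hF₃
    have hcoeff := Fintype.linearIndependent_iff.1 (hLI s)
      ![-(deriv γ s + κ s) * Real.cos (γ s) * Real.sin φ
          + τ' s * (Real.cos (γ s) * Real.sin (γ s) * (1 - Real.cos φ)),
        -(deriv γ s + κ s) * Real.sin (γ s) * Real.sin φ - τ s * Real.cos φ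
          + τ' s * (Real.sin (γ s) ^ 2 + Real.cos (γ s) ^ 2 * Real.cos φ),
        (τ s - τ' s) * Real.cos (γ s) * Real.sin φ, 0]
      (by
        simp only [Fin.sum_univ_four, Matrix.cons_val]
        simp only [Pi.neg_apply] at hF₃
        linear_combination (norm := module) (-1 : ℝ) • hF₃)
    have hc1 := hcoeff 0
    have hc3 := hcoeff 2
    simp only [Matrix.cons_val] at hc1 hc3
    have hτ' : τ' s = τ s := by
      have h := (mul_eq_zero.1 ((mul_eq_zero.1 hc3).resolve_right hφ)).resolve_right (hcosγ s)
      linarith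
    refine ⟨hτ', mul_left_cancel₀ (mul_ne_zero (hcosγ s) hφ) ?_⟩
    rw [hτ'] at hc1
    linear_combination -hc1
      - τ s * Real.sin (γ s) * Real.cos (γ s) * sin_mul_tan_half hφ
  exact ⟨fun s => (key s).1, fun s => eq_sub_of_add_eq (key s).2⟩
end

section
/- Let (E₁,E₂,E₃,E₄,κ,τ,σ) be a Galilean Frenet frame in G⁴, let γ : ℝ → ℝ be differentiable and φ ∈ ℝ a constant with sin φ ≠ 0, and suppose cos(γ(s)) ≠ 0 and sin(γ(s)) ≠ 0 for every s. If the spatially rotated frame (Ẽ₁,Ẽ₂,Ẽ₃,Ẽ₄) of (E₁,E₂,E₃,E₄) with angles γ, φ satisfies the first Frenet equation Ẽ₁' = κ̃·Ẽ₂ for some function κ̃ : ℝ → ℝ, then the curvature of the rotated frame satisfies κ̃(s) = −κ(s) − 2·(dγ/ds)(s) for all s. -/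
open Real

/-- Equal combinations of the first three of four independent vectors have equal first
coefficients. -/
theorem coeff_zero_eq_of_linearIndependent {R V : Type*} [Ring R] [AddCommGroup V] [Module R V]
    {u v w x : V} (h : LinearIndependent R ![u, v, w, x]) {a b c a' b' c' : R}
    (heq : a • u + b • v + c • w = a' • u + b' • v + c' • w) : a = a' := by
  have := Fintype.linearIndependent_iff.mp h ![a - a', b - b', c - c', 0] (by
    simp only [Fin.sum_univ_four, Matrix.cons_val, sub_smul, zero_smul, add_zero]
    rw [← sub_eq_zero] at heq
    rw [← heq]
    abel) 0
  exact sub_eq_zero.mp (by simpa using this)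

theorem stmt11
    (E₁ E₂ E₃ E₄ : ℝ → Fin 4 → ℝ) (κ τ σ : ℝ → ℝ)
    (hE₁ : Differentiable ℝ E₁) (hE₂ : Differentiable ℝ E₂)
    (hE₃ : Differentiable ℝ E₃) (hE₄ : Differentiable ℝ E₄)
    (hκ : Differentiable ℝ κ) (hτ : Differentiable ℝ τ) (hσ : Differentiable ℝ σ)
    (hLI : ∀ s : ℝ, LinearIndependent ℝ ![E₁ s, E₂ s, E₃ s, E₄ s])
    (hFr1 : ∀ s : ℝ, deriv E₁ s = κ s • E₂ s)
    (hFr2 : ∀ s : ℝ, deriv E₂ s = (-(κ s)) • E₁ s + τ s • E₃ s)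
    (hFr3 : ∀ s : ℝ, deriv E₃ s = (-(τ s)) • E₂ s)
    (hFr4 : ∀ s : ℝ, deriv E₄ s = (-(σ s)) • E₃ s)
    (γ : ℝ → ℝ) (hγ : Differentiable ℝ γ)
    (φ : ℝ) (hφ : Real.sin φ ≠ 0)
    (hcosγ : ∀ s : ℝ, Real.cos (γ s) ≠ 0)
    (hsinγ : ∀ s : ℝ, Real.sin (γ s) ≠ 0)
    (F₁ F₂ F₃ F₄ : ℝ → Fin 4 → ℝ)
    (hR1 : ∀ s : ℝ, F₁ s = (Real.cos (γ s) ^ 2 + Real.sin (γ s) ^ 2 * Real.cos φ) • E₁ s + (Real.cos (γ s) * Real.sin (γ s) * (1 - Real.cos φ)) • E₂ s + (Real.sin (γ s) * Real.sin φ) • E₃ s)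
    (hR2 : ∀ s : ℝ, F₂ s = (Real.cos (γ s) * Real.sin (γ s) * (1 - Real.cos φ)) • E₁ s + (Real.sin (γ s) ^ 2 + Real.cos (γ s) ^ 2 * Real.cos φ) • E₂ s + (-(Real.cos (γ s) * Real.sin φ)) • E₃ s)
    (hR3 : ∀ s : ℝ, F₃ s = (-(Real.sin (γ s) * Real.sin φ)) • E₁ s + (Real.sin φ * Real.cos (γ s)) • E₂ s + (Real.cos φ) • E₃ s)
    (hR4 : ∀ s : ℝ, F₄ s = E₄ s)
    (κ' : ℝ → ℝ)
    (hFr1' : ∀ s : ℝ, deriv F₁ s = κ' s • F₂ s) :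
    ∀ s : ℝ, κ' s = -κ s - 2 * deriv γ s := by
  intro s
  have hc := (hγ s).hasDerivAt.cos
  have hs := (hγ s).hasDerivAt.sin
  have h₁ := (hE₁ s).hasDerivAt
  have h₂ := (hE₂ s).hasDerivAt
  have h₃ := (hE₃ s).hasDerivAt
  rw [hFr1] at h₁
  rw [hFr2] at h₂
  rw [hFr3] at h₃
  have hF := ((((hc.fun_pow 2).fun_add ((hs.fun_pow 2).mul_const (cos φ))).fun_smul h₁).fun_add
    (((hc.fun_mul hs).mul_const (1 - cos φ)).fun_smul h₂)).fun_add
    ((hs.mul_const (sin φ)).fun_smul h₃)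
  rw [← funext hR1] at hF
  have hF' := hF.deriv
  rw [hFr1', hR2] at hF'
  have hE := coeff_zero_eq_of_linearIndependent (hLI s)
    (a := κ' s * (cos (γ s) * sin (γ s) * (1 - cos φ)))
    (a' := -(cos (γ s) * sin (γ s) * (1 - cos φ)) * (2 * deriv γ s + κ s))
    (b := κ' s * (sin (γ s) ^ 2 + cos (γ s) ^ 2 * cos φ))
    (b' := (cos (γ s) ^ 2 - sin (γ s) ^ 2) * (1 - cos φ) * deriv γ s
      + (cos (γ s) ^ 2 + sin (γ s) ^ 2 * cos φ) * κ s - sin (γ s) * sin φ * τ s)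
    (c := κ' s * -(cos (γ s) * sin φ))
    (c' := cos (γ s) * sin φ * deriv γ s + cos (γ s) * sin (γ s) * (1 - cos φ) * τ s)
    (by
      ext i
      have := congrFun hF' i
      simp only [Pi.add_apply, Pi.smul_apply, smul_eq_mul] at this ⊢
      push_cast at this
      linear_combination this)
  have hφ' : 1 - cos φ ≠ 0 := fun h ↦ hφ (by
    have := sin_sq_add_cos_sq φ
    rw [← sub_eq_zero.mp h] at this
    simpa using this)
  exact mul_left_cancel₀ (mul_ne_zero (mul_ne_zero (hcosγ s) (hsinγ s)) hφ')
    (by linear_combination hE)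
end
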